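/- Verified clauses remain verified along transitions of the E-matching operational semantics: if ⟨W, A, E⟩ → ⟨W′, A′, E′⟩, C ∈ A, and C is verified by (W, E^I), then C ∈ A′ and C is verified by (W′, E′^I). -/

import Mathlib

namespace EMatch

/-- Ground terms over a set `F` of function symbols. -/
inductive GTerm (F : Type) : Type where
  | app : F → List (GTerm F) → GTerm F

/-- E-interface literals: equalities and disequalities on ground terms. -/
inductive ELit (F : Type) : Type where
  | eq : GTerm F → GTerm F → ELit F
  | ne : GTerm F → GTerm F → ELit F

/-- An E-interface is a set of (dis)equality literals on ground terms. -/
abbrev EInterface (F : Type) := Set (ELit F)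

mutual
  /-- `Knows E t`: the ground term `t` is known in the E-interface `E`. -/
  inductive Knows {F : Type} (E : EInterface F) : GTerm F → Prop where
    | kn_eq {t₁ t₂ : GTerm F} : Entails E t₁ t₂ → Knows E t₁
    | kn_sub {g : F} {ts : List (GTerm F)} {t : GTerm F} :
        Knows E (.app g ts) → t ∈ ts → Knows E t
  /-- `Entails E t₁ t₂`: the ground terms `t₁` and `t₂` are known equal in `E`. -/
  inductive Entails {F : Type} (E : EInterface F) : GTerm F → GTerm F → Prop where
    | eq_in {t₁ t₂ : GTerm F} : ELit.eq t₁ t₂ ∈ E → Entails E t₁ t₂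
    | eq_sym {t₁ t₂ : GTerm F} : Entails E t₂ t₁ → Entails E t₁ t₂
    | eq_tran {t₁ t₂ t₃ : GTerm F} : Entails E t₁ t₂ → Entails E t₂ t₃ → Entails E t₁ t₃
    | eq_kn_refl {t : GTerm F} : Knows E t → Entails E t t
    | eq_kn_sub {g : F} {l₁ l₂ : List (GTerm F)} {tᵢ tᵢ' : GTerm F} :
        Entails E tᵢ tᵢ' → Knows E (.app g (l₁ ++ tᵢ :: l₂)) →
        Entails E (.app g (l₁ ++ tᵢ :: l₂)) (.app g (l₁ ++ tᵢ' :: l₂))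
end

/-- `EntailsNe E t₁ t₂`: `t₁` and `t₂` are known disequal in `E`. -/
inductive EntailsNe {F : Type} (E : EInterface F) : GTerm F → GTerm F → Prop where
  | ne_in {t₁ t₂ : GTerm F} : ELit.ne t₁ t₂ ∈ E → EntailsNe E t₁ t₂
  | ne_sym {t₁ t₂ : GTerm F} : EntailsNe E t₂ t₁ → EntailsNe E t₁ t₂
  | ne_eq {t₁ t₂ t₃ : GTerm F} : EntailsNe E t₁ t₂ → Entails E t₂ t₃ → EntailsNe E t₁ t₃

/-- The E-interface `E` is (logically) inconsistent. -/
def Inconsistent {F : Type} (E : EInterface F) : Prop :=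
  ∃ t₁ t₂ : GTerm F, Entails E t₁ t₂ ∧ EntailsNe E t₁ t₂

/-- Pointwise entailed equality of two vectors of ground terms (of the same length). -/
def EntailsVec {F : Type} (E : EInterface F) (r r' : List (GTerm F)) : Prop :=
  List.Forall₂ (Entails E) r r'

/-- `B` is a candidate basis of `E`. -/
def CandidateBasis {F : Type} (E : EInterface F) (B : Set (GTerm F)) : Prop :=
  ∀ t : GTerm F, Knows E t → ∃ b ∈ B, Entails E t b

/-- `B` is a basis of `E`. -/
def IsBasis {F : Type} (E : EInterface F) (B : Set (GTerm F)) : Prop :=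
  (∀ b ∈ B, Knows E b) ∧
  (∀ b₁ ∈ B, ∀ b₂ ∈ B, b₁ ≠ b₂ → ¬ Entails E b₁ b₂) ∧
  (∀ t : GTerm F, Knows E t → ∃ b ∈ B, Entails E t b)

end EMatch

namespace EMatch

/-- First-order terms over variables `V` and function symbols `F`. -/
inductive Term (V F : Type) : Type where
  | var : V → Term V F
  | app : F → List (Term V F) → Term V F

/-- Atoms (atomic formulas): equalities between terms, and predicate applications. -/
inductive Atom (V F P : Type) : Type where
  | eq : Term V F → Term V F → Atom V F P
  | pred : P → List (Term V F) → Atom V F P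

/-- Literals: atoms and their negations. -/
inductive Lit (V F P : Type) : Type where
  | pos : Atom V F P → Lit V F P
  | neg : Atom V F P → Lit V F P

/-- Tags identifying quantifiers: primitive tags from `PT`, possibly
parameterised by vectors of terms. -/
inductive QTag (PT V F : Type) : Type where
  | prim : PT → QTag PT V F
  | param : QTag PT V F → List (Term V F) → QTag PT V F

/-- Extended literals: either a literal or a tagged quantifier
`(∀x⃗.[T⃗]A)^#α` with bound variables `x⃗`, trigger sets `T⃗`, tag `#α` and an
ECNF body `A` (a list of clauses, each clause a list of extended literals). -/
inductive ExtLit (V F P PT : Type) : Type where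
  | lit : Lit V F P → ExtLit V F P PT
  | quant : List V → List (List (Term V F)) → QTag PT V F →
      List (List (ExtLit V F P PT)) → ExtLit V F P PT

/-- Extended clauses, as (disjunctive) lists of extended literals. -/
abbrev Clause (V F P PT : Type) := List (ExtLit V F P PT)

/-- `φ` is a tagged quantifier. -/
def ExtLit.isQuant {V F P PT : Type} : ExtLit V F P PT → Prop
  | .quant _ _ _ _ => True
  | .lit _ => False

/-- `φ` is a (simple) literal. -/
def ExtLit.isLit {V F P PT : Type} : ExtLit V F P PT → Prop
  | .quant _ _ _ _ => False
  | .lit _ => True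

/-- `filter_∀`: the tagged quantifiers of a set of extended literals. -/
def filterUni {V F P PT : Type} (Φ : Set (ExtLit V F P PT)) : Set (ExtLit V F P PT) :=
  {φ ∈ Φ | φ.isQuant}

/-- `filter_lit`: the (simple) literals of a set of extended literals. -/
def filterLit {V F P PT : Type} (Φ : Set (ExtLit V F P PT)) : Set (ExtLit V F P PT) :=
  {φ ∈ Φ | φ.isLit}

end EMatch

namespace EMatch

/-- Embedding of ground terms into terms. -/
def GTerm.toTerm {V F : Type} : GTerm F → Term V F
  | .app f ts => .app f (ts.attach.map fun t => t.1.toTerm)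
  decreasing_by simp_wf; have := List.sizeOf_lt_of_mem t.2; omega

/-- `g` is the ground version of the term `t`. -/
def IsGroundOf {V F : Type} (t : Term V F) (g : GTerm F) : Prop :=
  GTerm.toTerm g = t

/-- Substitution on terms. -/
def Term.subst {V F : Type} (σ : V → Term V F) : Term V F → Term V F
  | .var x => σ x
  | .app f ts => .app f (ts.attach.map fun t => t.1.subst σ)
  decreasing_by simp_wf; have := List.sizeOf_lt_of_mem t.2; omega

/-- Substitution on atoms. -/
def Atom.subst {V F P : Type} (σ : V → Term V F) : Atom V F P → Atom V F P
  | .eq t₁ t₂ => .eq (t₁.subst σ) (t₂.subst σ)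
  | .pred p ts => .pred p (ts.map (Term.subst σ))

/-- Substitution on literals. -/
def Lit.subst {V F P : Type} (σ : V → Term V F) : Lit V F P → Lit V F P
  | .pos a => .pos (a.subst σ)
  | .neg a => .neg (a.subst σ)

/-- Substitution on tags. -/
def QTag.subst {PT V F : Type} (σ : V → Term V F) : QTag PT V F → QTag PT V F
  | .prim p => .prim p
  | .param τ ts => .param (τ.subst σ) (ts.map (Term.subst σ))

/-- Mask a substitution on a list of (bound) variables. -/
def maskSubst {V F : Type} [DecidableEq V] (σ : V → Term V F) (xs : List V) :
    V → Term V F :=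
  fun v => if v ∈ xs then .var v else σ v

/-- Substitution on extended literals; bound variables of quantifiers shadow. -/
def ExtLit.subst {V F P PT : Type} [DecidableEq V] :
    (V → Term V F) → ExtLit V F P PT → ExtLit V F P PT
  | σ, .lit l => .lit (l.subst σ)
  | σ, .quant xs Ts τ body =>
      .quant xs (Ts.map fun T => T.map (Term.subst (maskSubst σ xs)))
        (τ.subst (maskSubst σ xs))
        (body.attach.map fun C =>
          C.1.attach.map fun φ => ExtLit.subst (maskSubst σ xs) φ.1)
  decreasing_by
    simp_wf
    have h1 := List.sizeOf_lt_of_mem φ.2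
    have h2 := List.sizeOf_lt_of_mem C.2
    omega

/-- The substitution `[r⃗/x⃗]` sending the variables `x⃗` pointwise to the
ground terms `r⃗` (and any other variable to itself). -/
def substOf {V F : Type} [DecidableEq V] (xs : List V) (r : List (GTerm F)) :
    V → Term V F :=
  fun v =>
    match (xs.zip r).find? (fun p => decide (p.1 = v)) with
    | some p => GTerm.toTerm p.2
    | none => .var v

end EMatch

namespace EMatch

/-- Symbols of the E-interface term language: function symbols, predicate
symbols (as Bool-valued functions) and the boolean constants ⊤ and ⊥. -/
abbrev FP (F P : Type) := F ⊕ P ⊕ Bool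

/-- Functorial action on ground terms. -/
def GTerm.mapF {F F' : Type} (h : F → F') : GTerm F → GTerm F'
  | .app f ts => .app (h f) (ts.attach.map fun t => t.1.mapF h)
  decreasing_by simp_wf; have := List.sizeOf_lt_of_mem t.2; omega

/-- Embedding of pure function terms into the E-interface term language. -/
def embed {F P : Type} : GTerm F → GTerm (FP F P) := GTerm.mapF Sum.inl

/-- The constant ⊤ of the E-interface term language. -/
def topT {F P : Type} : GTerm (FP F P) := .app (Sum.inr (Sum.inr true)) []

/-- The constant ⊥ of the E-interface term language. -/
def botT {F P : Type} : GTerm (FP F P) := .app (Sum.inr (Sum.inr false)) []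

/-- A ground literal of the formula language, rendered as an E-interface
literal: (dis)equalities are kept, and a positive (resp. negative)
non-equational literal `P(t⃗)` is rendered as `P(t⃗) = ⊤` (resp. `P(t⃗) = ⊥`). -/
inductive LitE {V F P : Type} : Lit V F P → ELit (FP F P) → Prop where
  | pos_eq {t₁ t₂ g₁ g₂} : IsGroundOf t₁ g₁ → IsGroundOf t₂ g₂ →
      LitE (.pos (.eq t₁ t₂)) (.eq (embed g₁) (embed g₂))
  | neg_eq {t₁ t₂ g₁ g₂} : IsGroundOf t₁ g₁ → IsGroundOf t₂ g₂ →
      LitE (.neg (.eq t₁ t₂)) (.ne (embed g₁) (embed g₂))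
  | pos_pred {p ts gs} : List.Forall₂ IsGroundOf ts gs →
      LitE (.pos (.pred p ts))
        (.eq (.app (Sum.inr (Sum.inl p)) (gs.map embed)) topT)
  | neg_pred {p ts gs} : List.Forall₂ IsGroundOf ts gs →
      LitE (.neg (.pred p ts))
        (.eq (.app (Sum.inr (Sum.inl p)) (gs.map embed)) botT)

/-- The E-interface literals denoted by the ground literals of a set of
extended literals. -/
def litsToE {V F P PT : Type} (Φ : Set (ExtLit V F P PT)) : Set (ELit (FP F P)) :=
  {e | ∃ l : Lit V F P, ExtLit.lit l ∈ Φ ∧ LitE l e}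

/-- Update `E ◁ L` of an E-interface with a set of literals: a minimal
E-interface satisfying all judgements `E` does and entailing every `l ∈ L`. -/
def updateE {F : Type} (E : EInterface F) (L : Set (ELit F)) : EInterface F := E ∪ L

/-- An E-interface literal is entailed. -/
def EntailsLit {F : Type} (E : EInterface F) : ELit F → Prop
  | .eq t₁ t₂ => Entails E t₁ t₂
  | .ne t₁ t₂ => EntailsNe E t₁ t₂

/-- Proper states (configurations) of the operational semantics: current
quantifiers `W`, current clauses `A`, and the E-state (E-interface, E-history). -/
structure Conf (V F P PT : Type) where
  W : Set (ExtLit V F P PT)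
  A : Set (Clause V F P PT)
  intf : EInterface (FP F P)
  hist : Set (QTag PT V F × List (GTerm F))

/-- States: a configuration, the inconsistent state ⊥, or the saturated state ◊. -/
inductive St (V F P PT : Type) where
  | conf : Conf V F P PT → St V F P PT
  | bot : St V F P PT
  | sat : St V F P PT

/-- An extended clause is verified by the current quantifiers and E-interface:
some disjunct is a tagged quantifier of `W`, or a literal entailed by the
E-interface. -/
def Verified {V F P PT : Type} (W : Set (ExtLit V F P PT)) (EI : EInterface (FP F P))
    (C : Clause V F P PT) : Prop :=
  ∃ φ ∈ C, (φ.isQuant ∧ φ ∈ W) ∨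
    (∃ (l : Lit V F P) (e : ELit (FP F P)), φ = .lit l ∧ LitE l e ∧ EntailsLit EI e)

/-- The E-state of a configuration enables `(#α : r⃗)`. -/
def EnablesC {V F P PT : Type} (c : Conf V F P PT) (α : QTag PT V F)
    (r : List (GTerm F)) : Prop :=
  ∀ r' : List (GTerm F), (α, r') ∈ c.hist →
    ¬ List.Forall₂ (fun a b => Entails c.intf (embed a) (embed b)) r r'

/-- The E-matching judgement `⟨W,A,E⟩ ⊢_match (∀x⃗.[T⃗]A′)^#α ◁ r⃗`. -/
def Matches {V F P PT : Type} [DecidableEq V] (c : Conf V F P PT)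
    (xs : List V) (Ts : List (List (Term V F))) (α : QTag PT V F)
    (body : List (Clause V F P PT)) (r : List (GTerm F)) : Prop :=
  ExtLit.quant xs Ts α body ∈ c.W ∧ r.length = xs.length ∧
  (∃ T ∈ Ts, ∀ t ∈ T, ∃ g : GTerm F,
      IsGroundOf (Term.subst (substOf xs r) t) g ∧ Knows c.intf (embed g)) ∧
  EnablesC c α r

/-- No E-match is enabled in the configuration. -/
def NoMatch {V F P PT : Type} [DecidableEq V] (c : Conf V F P PT) : Prop :=
  ¬ ∃ xs Ts α body r, Matches c xs Ts α body r

/-- The quantifiers occurring as unit clauses of an instantiated body. -/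
def unitQuants {V F P PT : Type} (body : List (Clause V F P PT)) :
    Set (ExtLit V F P PT) :=
  {φ | [φ] ∈ body ∧ φ.isQuant}

/-- The E-interface literals of the literals occurring as unit clauses of an
instantiated body. -/
def unitLits {V F P PT : Type} (body : List (Clause V F P PT)) :
    Set (ELit (FP F P)) :=
  {e | ∃ l : Lit V F P, [ExtLit.lit l] ∈ body ∧ LitE l e}

/-- The non-unit clauses of an instantiated body. -/
def nonUnits {V F P PT : Type} (body : List (Clause V F P PT)) :
    Set (Clause V F P PT) :=
  {C | C ∈ body ∧ C.length ≠ 1}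

/-- The (split) rule. -/
def SplitStep {V F P PT : Type} (c c' : Conf V F P PT) : Prop :=
  ∃ Φ : Set (ExtLit V F P PT), Φ.Nonempty ∧
    Φ ⊆ {φ | ∃ C ∈ c.A, ¬ Verified c.W c.intf C ∧ φ ∈ C} ∧
    c'.W = c.W ∪ filterUni Φ ∧
    c'.A = c.A ∧
    c'.intf = updateE c.intf (litsToE (filterLit Φ)) ∧
    c'.hist = c.hist

/-- The (inst) rule. -/
def InstStep {V F P PT : Type} [DecidableEq V] (c c' : Conf V F P PT) : Prop :=
  ∃ xs Ts α body r, Matches c xs Ts α body r ∧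
    ∃ body' : List (Clause V F P PT),
      body' = body.map (fun C => C.map (ExtLit.subst (substOf xs r))) ∧
      c'.W = c.W ∪ unitQuants body' ∧
      c'.A = c.A ∪ nonUnits body' ∧
      c'.intf = updateE c.intf (unitLits body') ∧
      c'.hist = insert (α, r) c.hist

/-- The transition relation of the E-matching operational semantics. -/
inductive Step {V F P PT : Type} [DecidableEq V] : St V F P PT → St V F P PT → Prop where
  | split {c c' : Conf V F P PT} : SplitStep c c' → Step (.conf c) (.conf c')
  | inst {c c' : Conf V F P PT} : InstStep c c' → Step (.conf c) (.conf c')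
  | to_bot {c : Conf V F P PT} : Inconsistent c.intf → Step (.conf c) .bot
  | to_sat {c : Conf V F P PT} : ¬ Inconsistent c.intf →
      (∀ C ∈ c.A, Verified c.W c.intf C) → NoMatch c → Step (.conf c) .sat

end EMatch

namespace EMatch

mutual
  theorem Knows.mono {F : Type} {E E' : EInterface F} (hE : E ⊆ E') {t : GTerm F} :
      Knows E t → Knows E' t
    | .kn_eq h => .kn_eq (h.mono hE)
    | .kn_sub h ht => .kn_sub (h.mono hE) ht
  theorem Entails.mono {F : Type} {E E' : EInterface F} (hE : E ⊆ E') {t₁ t₂ : GTerm F} :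
      Entails E t₁ t₂ → Entails E' t₁ t₂
    | .eq_in h => .eq_in (hE h)
    | .eq_sym h => .eq_sym (h.mono hE)
    | .eq_tran h₁ h₂ => .eq_tran (h₁.mono hE) (h₂.mono hE)
    | .eq_kn_refl h => .eq_kn_refl (h.mono hE)
    | .eq_kn_sub h₁ h₂ => .eq_kn_sub (h₁.mono hE) (h₂.mono hE)
end

theorem EntailsNe.mono {F : Type} {E E' : EInterface F} (hE : E ⊆ E') {t₁ t₂ : GTerm F}
    (h : EntailsNe E t₁ t₂) : EntailsNe E' t₁ t₂ := by
  induction h with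
  | ne_in h => exact .ne_in (hE h)
  | ne_sym _ ih => exact .ne_sym ih
  | ne_eq _ h ih => exact .ne_eq ih (h.mono hE)

theorem EntailsLit.mono {F : Type} {E E' : EInterface F} (hE : E ⊆ E') :
    ∀ {e : ELit F}, EntailsLit E e → EntailsLit E' e
  | .eq _ _, h => Entails.mono hE h
  | .ne _ _, h => EntailsNe.mono hE h

theorem Verified.mono {V F P PT : Type} {W W' : Set (ExtLit V F P PT)}
    {E E' : EInterface (FP F P)} (hW : W ⊆ W') (hE : E ⊆ E') {C : Clause V F P PT}
    (h : Verified W E C) : Verified W' E' C := by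
  obtain ⟨φ, hφ, ⟨hq, hm⟩ | ⟨l, e, hl, hle, he⟩⟩ := h
  · exact ⟨φ, hφ, .inl ⟨hq, hW hm⟩⟩
  · exact ⟨φ, hφ, .inr ⟨l, e, hl, hle, he.mono hE⟩⟩

/-- Transitions between configurations only enlarge the quantifiers, the clauses and the
E-interface. -/
theorem Step.subset {V F P PT : Type} [DecidableEq V] {c c' : Conf V F P PT}
    (h : Step (St.conf c) (St.conf c')) :
    c.W ⊆ c'.W ∧ c.A ⊆ c'.A ∧ c.intf ⊆ c'.intf := by
  cases h with
  | split h =>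
    obtain ⟨Φ, -, -, hW, hA, hE, -⟩ := h
    rw [hW, hA, hE]
    exact ⟨Set.subset_union_left, subset_rfl, Set.subset_union_left⟩
  | inst h =>
    obtain ⟨xs, Ts, α, body, r, -, body', -, hW, hA, hE, -⟩ := h
    rw [hW, hA, hE]
    exact ⟨Set.subset_union_left, Set.subset_union_left, Set.subset_union_left⟩

end EMatch

open EMatch in
/-- verified clauses remain verified along transitions: if
`⟨W,A,E⟩ → ⟨W′,A′,E′⟩`, `C ∈ A`, and `C` is verified by `(W, E^I)`, then
`C ∈ A′` and `C` is verified by `(W′, E′^I)`. -/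
theorem verified_preserved {V F P PT : Type} [DecidableEq V]
    (c c' : Conf V F P PT) (h : Step (St.conf c) (St.conf c'))
    (C : Clause V F P PT) (hC : C ∈ c.A) (hv : Verified c.W c.intf C) :
    C ∈ c'.A ∧ Verified c'.W c'.intf C := by
  obtain ⟨hW, hA, hE⟩ := h.subset
  exact ⟨hA hC, hv.mono hW hE⟩
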